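/- Let Γ be a group acting measurably on a probability space (X, μ) by measure-preserving maps, let G′ be a measurable group (multiplication and inversion measurable), and let σ : Γ × X → G′ be a measurable cocycle, i.e. σ(γ, ·) : X → G′ is measurable for every γ ∈ Γ and for all γ₁, γ₂ ∈ Γ and μ-almost every x ∈ X, σ(γ₁γ₂, x) = σ(γ₁, γ₂ • x) * σ(γ₂, x). Let k ≥ 1 and let ψ : (G′)^k → ℝ be bounded, measurable and G′-invariant, i.e. ψ(g·h₁, …, g·h_k) = ψ(h₁, …, h_k) for all g, h₁, …, h_k ∈ G′. Define C(σ)(ψ)(γ₁, …, γ_k) := ∫_X ψ(σ(γ₁⁻¹, x)⁻¹, …, σ(γ_k⁻¹, x)⁻¹) dμ(x). Then C(σ)(ψ) is Γ-invariant: for all γ, γ₁, …, γ_k ∈ Γ, C(σ)(ψ)(γγ₁, …, γγ_k) = C(σ)(ψ)(γ₁, …, γ_k). -/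

import Mathlib

open MeasureTheory

/-- The pullback `C(σ)(ψ)(γ₁, …, γ_k) = ∫_X ψ(σ(γ₁⁻¹, x)⁻¹, …, σ(γ_k⁻¹, x)⁻¹) dμ`
of a bounded measurable `G'`-invariant cochain `ψ` along a measurable cocycle `σ`
is `Γ`-invariant. -/
theorem pullback_along_cocycle_invariant {Γ G' X : Type*} [Group Γ] [Group G']
    [MeasurableSpace G'] [MeasurableMul₂ G'] [MeasurableInv G']
    [MeasurableSpace X] [MulAction Γ X]
    (μ : Measure X) [IsProbabilityMeasure μ]
    (hmp : ∀ γ : Γ, MeasurePreserving (fun x : X => γ • x) μ μ)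
    (σ : Γ → X → G') (hσmeas : ∀ γ : Γ, Measurable (σ γ))
    (hσ : ∀ γ₁ γ₂ : Γ, ∀ᵐ x ∂μ, σ (γ₁ * γ₂) x = σ γ₁ (γ₂ • x) * σ γ₂ x)
    (k : ℕ) (hk : 1 ≤ k) (ψ : (Fin k → G') → ℝ) (C : ℝ)
    (hψbd : ∀ h, |ψ h| ≤ C) (hψmeas : Measurable ψ)
    (hψinv : ∀ (g : G') (h : Fin k → G'), ψ (fun i => g * h i) = ψ h) :
    ∀ (γ : Γ) (γs : Fin k → Γ),
      (∫ x, ψ (fun i => (σ (γ * γs i)⁻¹ x)⁻¹) ∂μ) =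
        ∫ x, ψ (fun i => (σ (γs i)⁻¹ x)⁻¹) ∂μ := by
  intro γ γs
  have hF : Measurable fun x => ψ fun i => (σ (γs i)⁻¹ x)⁻¹ :=
    hψmeas.comp (measurable_pi_lambda _ fun i => (hσmeas _).inv)
  have hae : (fun x => ψ fun i => (σ (γ * γs i)⁻¹ x)⁻¹) =ᵐ[μ]
      fun x => ψ fun i => (σ (γs i)⁻¹ (γ⁻¹ • x))⁻¹ := by
    filter_upwards [ae_all_iff.2 fun i => hσ (γs i)⁻¹ γ⁻¹] with x hx
    simp only [mul_inv_rev, hx, hψinv]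
  rw [integral_congr_ae hae]
  conv_rhs => rw [← (hmp γ⁻¹).map_eq]
  exact (integral_map (hmp γ⁻¹).measurable.aemeasurable hF.aestronglyMeasurable).symm
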